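/- A strongly primary domain R is globally tame if and only if Λ(R) = ∞. -/

import Mathlib

section DomainDefs

variable (R : Type*) [CommRing R] [IsDomain R]

/-- The set of lengths of `a ∈ R•`: all `k` such that `a` is a product of `k`
irreducible elements (up to a unit). -/
def lengthSetD (a : R) : Set ℕ :=
  {k | ∃ s : Multiset R, Multiset.card s = k ∧ (∀ b ∈ s, Irreducible b) ∧ Associated s.prod a}

/-- `Λ(R)`, the supremum of the minimal factorization lengths of nonzero elements. -/
noncomputable def LambdaD : ℕ∞ :=
  ⨆ (a : R) (_ : a ≠ 0) (_ : (lengthSetD R a).Nonempty), ((sInf (lengthSetD R a) : ℕ) : ℕ∞)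

/-- `ρ_k(R)`, the supremum of `sup L(a)` over all nonzero `a` with `k ∈ L(a)`. -/
noncomputable def rhoD (k : ℕ) : ℕ∞ :=
  ⨆ (a : R) (_ : a ≠ 0) (_ : k ∈ lengthSetD R a),
    ⨆ (n : ℕ) (_ : n ∈ lengthSetD R a), (n : ℕ∞)

/-- The elasticity `ρ(R)`. -/
noncomputable def elasticityD : ENNReal :=
  ⨆ (a : R) (_ : a ≠ 0) (m : ℕ) (_ : m ∈ lengthSetD R a) (n : ℕ) (_ : n ∈ lengthSetD R a),
    (m : ENNReal) / (n : ENNReal)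

/-- `z` is a factorization of `a`: a multiset of irreducibles whose product is
associated to `a`. -/
def IsFactorizationD (a : R) (z : Multiset R) : Prop :=
  (∀ v ∈ z, Irreducible v) ∧ Associated z.prod a

/-- The distance between two factorizations: cancel a (maximal) common part (up to
associates) and take the maximum of the lengths of the remaining parts. -/
noncomputable def fdistD (z z' : Multiset R) : ℕ :=
  sInf {N : ℕ | ∃ x x' v w : Multiset R, z = x + v ∧ z' = x' + w ∧
    Multiset.Rel Associated x x' ∧ max (Multiset.card v) (Multiset.card w) ≤ N}

/-- `N` is a tame bound for the irreducible element `u`. -/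
def TameBoundD (u : R) (N : ℕ) : Prop :=
  ∀ a : R, a ≠ 0 → u ∣ a → ∀ z : Multiset R, IsFactorizationD R a z →
    ∃ z' : Multiset R, IsFactorizationD R a z' ∧ (∃ v ∈ z', Associated v u) ∧ fdistD R z z' ≤ N

/-- `R` is locally tame: `t(u) < ∞` for every irreducible `u`. -/
def LocallyTameD : Prop := ∀ u : R, Irreducible u → ∃ N : ℕ, TameBoundD R u N

/-- `R` is globally tame: `sup { t(u) : u irreducible } < ∞`. -/
def GloballyTameD : Prop := ∃ N : ℕ, ∀ u : R, Irreducible u → TameBoundD R u N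

/-- `R` is a strongly primary domain: local with nonzero maximal ideal, and
every nonzero principal ideal contains a power of the maximal ideal. -/
def StronglyPrimaryDomain [IsLocalRing R] : Prop :=
  IsLocalRing.maximalIdeal R ≠ ⊥ ∧
    ∀ r : R, r ≠ 0 → ∃ n : ℕ, 0 < n ∧ IsLocalRing.maximalIdeal R ^ n ≤ Ideal.span {r}

variable (K : Type*) [Field K] [Algebra R K] [IsFractionRing R K]

/-- `y ∈ K` lies in (the image of) `R`. -/
def inR (y : K) : Prop := ∃ r : R, y = algebraMap R K r

/-- `x ∈ K` lies in the complete integral closure `R̂` of `R`. -/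
def inHat (x : K) : Prop :=
  ∃ c : R, c ≠ 0 ∧ ∀ n : ℕ, inR R K (algebraMap R K c * x ^ n)

/-- `z ∈ K` lies in the conductor `(R : R̂)`. -/
def inConductor (z : K) : Prop := ∀ x : K, inHat R K x → inR R K (z * x)

/-- `R̂` is a primary domain, i.e. its monoid of nonzero elements is primary. -/
def HatPrimaryD : Prop :=
  (∃ x : K, inHat R K x ∧ x ≠ 0 ∧ ¬ inHat R K x⁻¹) ∧
    ∀ a b : K, (inHat R K a ∧ a ≠ 0 ∧ ¬ inHat R K a⁻¹) →
      (inHat R K b ∧ b ≠ 0 ∧ ¬ inHat R K b⁻¹) →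
        ∃ n : ℕ, 0 < n ∧ ∃ c : K, inHat R K c ∧ b ^ n = a * c

/-- `R̂` is a valuation domain. -/
def HatValuationD : Prop :=
  ∀ a b : K, inHat R K a → inHat R K b →
    (∃ c : K, inHat R K c ∧ b = a * c) ∨ (∃ c : K, inHat R K c ∧ a = b * c)

/-- An ideal `I` of `R` is divisorial: `I = (R : (R : I))`. -/
def IsDivisorialIdeal (I : Ideal R) : Prop :=
  ∀ x : R, (∀ z : K, (∀ y ∈ I, inR R K (z * algebraMap R K y)) →
    inR R K (z * algebraMap R K x)) → x ∈ I

/-- `R` is a Mori domain: the ascending chain condition holds for integral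
divisorial ideals. -/
def MoriDomain : Prop :=
  ∀ f : ℕ → Ideal R, (∀ n, IsDivisorialIdeal R K (f n)) → (∀ n, f n ≤ f (n + 1)) →
    ∃ n : ℕ, ∀ m : ℕ, n ≤ m → f m = f n

end DomainDefs

namespace StronglyPrimaryDomain

open IsLocalRing

/-- `a` is, up to a unit, a product of at most `n` irreducible elements. -/
def HasShortFactorization {R : Type*} [CommRing R] [IsDomain R] (a : R) (n : ℕ) : Prop :=
  ∃ s : Multiset R, Multiset.card s ≤ n ∧ IsFactorizationD R a s

lemma fdistD_add_le {R : Type*} [CommRing R] (x v w : Multiset R) :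
    fdistD R (x + v) (x + w) ≤ max (Multiset.card v) (Multiset.card w) :=
  Nat.sInf_le ⟨x, x, v, w, rfl, rfl, Multiset.rel_refl_of_refl_on fun _ _ => .refl _, le_rfl⟩

section Domain

variable {R : Type*} [CommRing R] [IsDomain R]

lemma HasShortFactorization.mul {a b : R} {m n : ℕ} (ha : HasShortFactorization a m)
    (hb : HasShortFactorization b n) : HasShortFactorization (a * b) (m + n) := by
  obtain ⟨s, hs, hsi, hsa⟩ := ha
  obtain ⟨t, ht, hti, hta⟩ := hb
  refine ⟨s + t, by rw [Multiset.card_add]; omega, fun v hv => ?_, ?_⟩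
  · rcases Multiset.mem_add.1 hv with h | h
    exacts [hsi v h, hti v h]
  · rw [Multiset.prod_add]
    exact hsa.mul_mul hta

lemma HasShortFactorization.mono {a : R} {m n : ℕ} (ha : HasShortFactorization a m)
    (h : m ≤ n) : HasShortFactorization a n := by
  obtain ⟨s, hs, hsa⟩ := ha
  exact ⟨s, hs.trans h, hsa⟩

lemma HasShortFactorization.of_associated {a b : R} {n : ℕ} (ha : HasShortFactorization a n)
    (h : Associated a b) : HasShortFactorization b n := by
  obtain ⟨s, hs, hsi, hsa⟩ := ha
  exact ⟨s, hs, hsi, hsa.trans h⟩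

lemma hasShortFactorization_pow {b : R} (hb : Irreducible b) (n : ℕ) :
    HasShortFactorization (b ^ n) n :=
  ⟨Multiset.replicate n b, by simp, fun v hv => (Multiset.eq_of_mem_replicate hv) ▸ hb, by simp⟩

/-- If `b ∤ c` but `c ^ 2 ^ a` is divisible by `b ^ (z * 2 ^ a)` with `z ≥ h`, then already the
square of some element not divisible by `b` is divisible by `b ^ h`. -/
lemma exists_pow_dvd_sq {b : R} (hb : b ≠ 0)
    (hfin : ∀ x : R, x ≠ 0 → FiniteMultiplicity b x) {h : ℕ} (a : ℕ) :
    ∀ (c : R) (z : ℕ), 0 < z → h ≤ z → ¬ b ∣ c →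
      b ^ (z * 2 ^ a) ∣ c ^ 2 ^ a → ∃ g : R, ¬ b ∣ g ∧ b ^ h ∣ g ^ 2 := by
  induction a with
  | zero =>
    intro c z hz _ hbc hd
    exact absurd ((dvd_pow_self b (by simpa using hz.ne')).trans (by simpa using hd)) hbc
  | succ a ih =>
    intro c z hz hhz hbc hd
    by_cases hsq : b ^ z ∣ c ^ 2
    · exact ⟨c, hbc, (pow_dvd_pow b hhz).trans hsq⟩
    have hc : c ^ 2 ≠ 0 := fun h0 => hsq (h0 ▸ dvd_zero _)
    obtain ⟨g, hg, hbg⟩ := (hfin _ hc).exists_eq_pow_mul_and_not_dvd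
    set q := multiplicity b (c ^ 2)
    have hq : q < z := by
      by_contra! hq
      exact hsq ((pow_dvd_pow b hq).trans (hg ▸ dvd_mul_right _ _))
    have hcg : c ^ 2 ^ (a + 1) = b ^ (q * 2 ^ a) * g ^ 2 ^ a := by
      rw [pow_succ' 2 a, pow_mul c, hg, mul_pow, pow_mul]
    have hz2 : z * 2 ^ (a + 1) = q * 2 ^ a + (2 * z - q) * 2 ^ a := by
      rw [← add_mul, show q + (2 * z - q) = 2 * z by omega]; ring
    refine ih g (2 * z - q) (by omega) (by omega) hbg ?_
    rw [hcg, hz2, pow_add] at hd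
    exact (mul_dvd_mul_iff_left (pow_ne_zero _ hb)).1 hd

/-- A step function on `ℕ` starting at `0` with bounded increments comes close to every value
if it is unbounded. -/
lemma exists_le_lt_add {k : ℕ → ℕ} {s : ℕ} (h0 : k 0 = 0) (hstep : ∀ n, k (n + 1) ≤ k n + s)
    (hunb : ∀ B, ∃ n, B < k n) (j : ℕ) : ∃ n, k n ≤ j ∧ j < k n + s := by
  have hex := hunb j
  classical
  have hlt := Nat.find_spec hex
  have hmin : ∀ i < Nat.find hex, k i ≤ j := fun i hi => not_lt.1 (Nat.find_min hex hi)
  cases hn : Nat.find hex with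
  | zero => rw [hn, h0] at hlt; omega
  | succ n =>
    rw [hn] at hlt
    exact ⟨n, hmin n (by omega), hlt.trans_le (hstep n)⟩

end Domain

section LocalRing

variable {R : Type*} [CommRing R] [IsLocalRing R]

lemma prod_mem_pow_card {s : Multiset R} (hs : ∀ v ∈ s, Irreducible v) :
    s.prod ∈ maximalIdeal R ^ Multiset.card s := by
  induction s using Multiset.induction with
  | empty => simp
  | cons v s ih =>
    rw [Multiset.prod_cons, Multiset.card_cons, pow_succ']
    exact Ideal.mul_mem_mul ((mem_maximalIdeal v).2 (hs v (by simp)).not_isUnit)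
      (ih fun w hw => hs w (Multiset.mem_cons_of_mem hw))

lemma exists_isFactorization_of_notMem_pow (n : ℕ) :
    ∀ a : R, a ∉ maximalIdeal R ^ n → ∃ s, IsFactorizationD R a s := by
  induction n with
  | zero => intro a ha; simp at ha
  | succ n ih =>
    intro a ha
    by_cases hu : IsUnit a
    · exact ⟨0, by simp, by simpa using (associated_one_iff_isUnit.2 hu).symm⟩
    by_cases hi : Irreducible a
    · exact ⟨{a}, by simpa using hi, by simp⟩
    obtain ⟨x, y, hxy, hx, hy⟩ : ∃ x y, a = x * y ∧ ¬ IsUnit x ∧ ¬ IsUnit y := by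
      by_contra! h
      exact hi ⟨hu, fun x y hxy => or_iff_not_imp_left.2 (h x y hxy)⟩
    have hxM := (mem_maximalIdeal x).2 hx
    have hyM := (mem_maximalIdeal y).2 hy
    obtain ⟨s, hsi, hs⟩ := ih x fun h => ha (by
      rw [hxy, pow_succ]; exact Ideal.mul_mem_mul h hyM)
    obtain ⟨t, hti, ht⟩ := ih y fun h => ha (by
      rw [hxy, pow_succ']; exact Ideal.mul_mem_mul hxM h)
    refine ⟨s + t, fun v hv => ?_, ?_⟩
    · rcases Multiset.mem_add.1 hv with h | h
      exacts [hsi v h, hti v h]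
    · rw [Multiset.prod_add, hxy]
      exact hs.mul_mul ht

lemma exists_dvd_pow (hR : StronglyPrimaryDomain R) {b u : R} (hb : ¬ IsUnit b) (hu : u ≠ 0) :
    ∃ n, u ∣ b ^ n := by
  obtain ⟨n, -, hn⟩ := hR.2 u hu
  exact ⟨n, Ideal.mem_span_singleton.1
    (hn (Ideal.pow_mem_pow ((mem_maximalIdeal b).2 hb) n))⟩

end LocalRing

variable {R : Type*} [CommRing R] [IsDomain R] [IsLocalRing R]

lemma exists_notMem_pow (hR : StronglyPrimaryDomain R) {a : R} (ha : a ≠ 0) :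
    ∃ n, a ∉ maximalIdeal R ^ n := by
  obtain ⟨n, -, hn⟩ := hR.2 a ha
  refine ⟨n + 1, fun h => ?_⟩
  rw [pow_succ'] at h
  obtain ⟨m, hm, hma⟩ := Ideal.mem_mul_span_singleton.1 (Ideal.mul_mono_right hn h)
  have h1 : m = 1 := mul_right_cancel₀ ha (by rw [hma, one_mul])
  exact (Ideal.ne_top_iff_one _).1 (maximalIdeal.isMaximal R).ne_top (h1 ▸ hm)

lemma exists_isFactorization (hR : StronglyPrimaryDomain R) {a : R} (ha : a ≠ 0) :
    ∃ s, IsFactorizationD R a s :=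
  let ⟨n, hn⟩ := exists_notMem_pow hR ha
  exists_isFactorization_of_notMem_pow n a hn

lemma exists_irreducible (hR : StronglyPrimaryDomain R) : ∃ b : R, Irreducible b := by
  obtain ⟨a, haM, ha⟩ := Submodule.exists_mem_ne_zero_of_ne_bot hR.1
  obtain ⟨s, hsi, hs⟩ := exists_isFactorization hR ha
  rcases Multiset.empty_or_exists_mem s with rfl | ⟨b, hb⟩
  · exact absurd (associated_one_iff_isUnit.1 (by simpa using hs.symm))
      ((mem_maximalIdeal a).1 haM)
  · exact ⟨b, hsi b hb⟩

lemma finiteMultiplicity (hR : StronglyPrimaryDomain R) {b a : R} (hb : ¬ IsUnit b)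
    (ha : a ≠ 0) : FiniteMultiplicity b a := by
  obtain ⟨n, hn⟩ := exists_notMem_pow hR ha
  refine ⟨n, fun h => hn ?_⟩
  exact Ideal.mem_of_dvd _ ((pow_dvd_pow b n.le_succ).trans h)
    (Ideal.pow_mem_pow ((mem_maximalIdeal b).2 hb) n)

/-- Elements outside a fixed nonzero principal ideal have factorizations of bounded length. -/
lemma exists_hasShortFactorization (hR : StronglyPrimaryDomain R) {b : R} (hb : b ≠ 0) :
    ∃ m, ∀ c : R, ¬ b ∣ c → HasShortFactorization c m := by
  obtain ⟨m, -, hm⟩ := hR.2 b hb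
  refine ⟨m, fun c hc => ?_⟩
  obtain ⟨s, hs⟩ := exists_isFactorization hR (a := c) fun h => hc (h ▸ dvd_zero b)
  refine ⟨s, ?_, hs⟩
  by_contra! hlt
  exact hc ((Ideal.mem_span_singleton.1
    (hm (Ideal.pow_le_pow_right hlt.le (prod_mem_pow_card hs.1)))).trans hs.2.dvd)

lemma lambda_ne_top (hR : StronglyPrimaryDomain R) {b : R} (hb : Irreducible b) {C : ℕ}
    (hC : ∀ k, HasShortFactorization (b ^ k) C) : LambdaD R ≠ ⊤ := by
  obtain ⟨m, hm⟩ := exists_hasShortFactorization hR hb.ne_zero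
  refine ne_top_of_le_ne_top (ENat.natCast_ne_top (C + m)) ?_
  refine iSup_le fun a => iSup_le fun ha => iSup_le fun _ => ?_
  obtain ⟨c, hc, hbc⟩ := (finiteMultiplicity hR hb.not_isUnit ha).exists_eq_pow_mul_and_not_dvd
  obtain ⟨s, hs, hsi, hsa⟩ := (hC _).mul (hm c hbc)
  rw [← hc] at hsa
  have hmem : Multiset.card s ∈ lengthSetD R a := ⟨s, rfl, hsi, hsa⟩
  exact_mod_cast (Nat.sInf_le hmem).trans hs

/-- If `Λ(R) = ∞`, then squares of elements prime to `b` have bounded `b`-order. -/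
lemma exists_not_pow_dvd_sq (hR : StronglyPrimaryDomain R) {b : R} (hb : Irreducible b)
    (hL : LambdaD R = ⊤) : ∃ r, ∀ g : R, ¬ b ∣ g → ¬ b ^ r ∣ g ^ 2 := by
  by_contra! hcon
  obtain ⟨m, hm⟩ := exists_hasShortFactorization hR hb.ne_zero
  have heven : ∀ e, HasShortFactorization (b ^ (2 * e)) (m + m) := by
    intro e
    rcases Nat.eq_zero_or_pos e with rfl | he
    · exact ⟨0, by simp, by simp, by simp⟩
    obtain ⟨g, hbg, x, hx⟩ := hcon (2 * e + 1)
    have hbe : b ∣ b ^ e := dvd_pow_self b he.ne'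
    have hplus : ¬ b ∣ b ^ e + g := fun h => hbg ((dvd_add_right hbe).1 h)
    have hminus : ¬ b ∣ b ^ e - g := fun h => hbg ((dvd_sub_right hbe).1 h)
    have hunit : IsUnit (1 - b * x) := by
      by_contra h
      have h1 := (maximalIdeal R).add_mem ((mem_maximalIdeal _).2 h)
        ((maximalIdeal R).mul_mem_right x ((mem_maximalIdeal b).2 hb.not_isUnit))
      rw [sub_add_cancel] at h1
      exact (mem_maximalIdeal (1 : R)).1 h1 isUnit_one
    refine ((hm _ hplus).mul (hm _ hminus)).of_associated ?_
    have heq : (b ^ e + g) * (b ^ e - g) = b ^ (2 * e) * (1 - b * x) := by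
      linear_combination -hx
    rw [heq]
    exact associated_mul_unit_left _ _ hunit
  refine lambda_ne_top hR hb (C := m + m + 1) (fun k => ?_) hL
  have := ((heven (k / 2)).mul (hasShortFactorization_pow hb (k % 2))).mono
    (n := m + m + 1) (by omega)
  rwa [← pow_add, Nat.div_add_mod] at this

/-- If `Λ(R) = ∞` and `c d = b ^ s`, then `b` divides the powers of `c` and `d` almost as often
as possible. -/
lemma exists_le_multiplicity_add (hR : StronglyPrimaryDomain R) {b : R} (hb : Irreducible b)
    (hL : LambdaD R = ⊤) {c d : R} {s : ℕ} (hcd : c * d = b ^ s) :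
    ∃ B, ∀ n, s * n ≤ multiplicity b (c ^ n) + multiplicity b (d ^ n) + B := by
  by_contra! hcon
  have hcd0 : c * d ≠ 0 := hcd ▸ pow_ne_zero _ hb.ne_zero
  have hc := left_ne_zero_of_mul hcd0
  have hd := right_ne_zero_of_mul hcd0
  have hfin : ∀ {x : R} (n : ℕ), x ≠ 0 → FiniteMultiplicity b (x ^ n) := fun n hx =>
    finiteMultiplicity hR hb.not_isUnit (pow_ne_zero n hx)
  obtain ⟨m, hm⟩ := exists_hasShortFactorization hR hb.ne_zero
  set p : ℕ → ℕ := fun n => multiplicity b (c ^ n)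
  set q : ℕ → ℕ := fun n => multiplicity b (d ^ n)
  have hmono : ∀ {x : R} (n : ℕ), x ≠ 0 →
      multiplicity b (x ^ n) ≤ multiplicity b (x ^ (n + 1)) := fun {x} n hx =>
    (hfin (n + 1) hx).le_multiplicity_of_pow_dvd
      ((pow_multiplicity_dvd b (x ^ n)).trans (pow_dvd_pow x n.le_succ))
  have hshort : ∀ n, HasShortFactorization (b ^ (s * n - (p n + q n))) (m + m) := by
    intro n
    obtain ⟨c', hc', hbc'⟩ := (hfin n hc).exists_eq_pow_mul_and_not_dvd
    obtain ⟨d', hd', hbd'⟩ := (hfin n hd).exists_eq_pow_mul_and_not_dvd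
    have heq : b ^ (p n + q n) * (c' * d') = b ^ (s * n) := by
      rw [pow_mul, ← hcd, mul_pow, hc', hd', pow_add]
      ring
    have hle : p n + q n ≤ s * n :=
      (pow_dvd_pow_iff hb.ne_zero hb.not_isUnit).1 (heq ▸ dvd_mul_right _ _)
    have heq' : c' * d' = b ^ (s * n - (p n + q n)) := by
      refine mul_left_cancel₀ (pow_ne_zero (p n + q n) hb.ne_zero) ?_
      rw [heq, ← pow_add, Nat.add_sub_cancel' hle]
    exact heq' ▸ (hm c' hbc').mul (hm d' hbd')
  refine lambda_ne_top hR hb (C := m + m + s) (fun k => ?_) hL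
  obtain ⟨n, hn, hn'⟩ := exists_le_lt_add (k := fun n => s * n - (p n + q n)) (s := s)
    (by simp) (fun n => by
      have h1 : p n ≤ p (n + 1) := hmono n hc
      have h2 : q n ≤ q (n + 1) := hmono n hd
      simp only [mul_add, mul_one]
      omega)
    (fun B => by
      obtain ⟨n, hn⟩ := hcon B
      exact ⟨n, by change B < s * n - (multiplicity b (c ^ n) + multiplicity b (d ^ n)); omega⟩) k
  have := ((hshort n).mul (hasShortFactorization_pow hb (k - (s * n - (p n + q n))))).mono
    (n := m + m + s) (by omega)
  rwa [← pow_add, Nat.add_sub_cancel' hn] at this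

lemma exists_irreducible_dvd_pow (hR : StronglyPrimaryDomain R) {b : R} (hb : Irreducible b)
    (hL : LambdaD R = ⊤) : ∃ N, ∀ u : R, Irreducible u → u ∣ b ^ N := by
  obtain ⟨r, hr⟩ := exists_not_pow_dvd_sq hR hb hL
  refine ⟨2 * r + 3, fun u hu => ?_⟩
  by_cases hbu : b ∣ u
  · exact ((hb.dvd_irreducible_iff_associated hu).1 hbu).symm.dvd.trans
      (dvd_pow_self b (by omega))
  classical
  have hex := exists_dvd_pow hR hb.not_isUnit hu.ne_zero
  set s := Nat.find hex with hs
  obtain ⟨d, hd⟩ := Nat.find_spec hex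
  rw [← hs] at hd
  have hs0 : s ≠ 0 := fun h => hu.not_isUnit
    (IsUnit.of_mul_eq_one d (by rw [← hd, h, pow_zero]))
  have hbd : ¬ b ∣ d := by
    rintro ⟨e, rfl⟩
    refine Nat.find_min hex (m := s - 1) (by omega) ⟨e, ?_⟩
    refine mul_left_cancel₀ hb.ne_zero ?_
    rw [← pow_succ', Nat.sub_add_cancel (by omega), hd]
    ring
  suffices hs' : s ≤ 2 * r + 3 from (Dvd.intro d hd.symm).trans (pow_dvd_pow b hs')
  by_contra! hlt
  obtain ⟨B, hB⟩ := exists_le_multiplicity_add hR hb hL hd.symm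
  have hpow : B < 2 ^ B := Nat.lt_two_pow_self
  have key := hB (2 ^ B)
  have hfin := fun x (hx : x ≠ 0) => finiteMultiplicity hR hb.not_isUnit (a := x) hx
  have hfinal : ∀ x : R, ¬ b ∣ x → (r + 1) * 2 ^ B ≤ multiplicity b (x ^ 2 ^ B) → False := by
    intro x hx hle
    obtain ⟨g, hg, hg'⟩ := exists_pow_dvd_sq hb.ne_zero hfin (h := r + 1) B x (r + 1)
      (by omega) le_rfl hx ((pow_dvd_pow b hle).trans (pow_multiplicity_dvd _ _))
    exact hr g hg ((pow_dvd_pow b r.le_succ).trans hg')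
  have hbig : (2 * r + 4) * 2 ^ B ≤ s * 2 ^ B := Nat.mul_le_mul_right _ hlt
  by_cases hle : (r + 1) * 2 ^ B ≤ multiplicity b (u ^ 2 ^ B)
  · exact hfinal u hbu hle
  · refine hfinal d hbd ?_
    nlinarith

lemma globallyTame_of_lambda_eq_top (hR : StronglyPrimaryDomain R) (hL : LambdaD R = ⊤) :
    GloballyTameD R := by
  obtain ⟨b, hb⟩ := exists_irreducible hR
  obtain ⟨N, hN⟩ := exists_irreducible_dvd_pow hR hb hL
  obtain ⟨n, -, hn⟩ := hR.2 (b ^ N) (pow_ne_zero _ hb.ne_zero)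
  obtain ⟨l, hl⟩ := exists_notMem_pow hR (pow_ne_zero (N * n) hb.ne_zero)
  refine ⟨n + l + 1, fun u hu a ha hua z hz => ?_⟩
  obtain ⟨v, hvz, hvn, huv⟩ : ∃ v ≤ z, Multiset.card v ≤ n ∧ u ∣ v.prod := by
    rcases le_total (Multiset.card z) n with h | h
    · exact ⟨z, le_rfl, h, hua.trans hz.2.symm.dvd⟩
    · obtain ⟨v, hv⟩ := Multiset.card_pos_iff_exists_mem.1
        (Multiset.card_powersetCard n z ▸ Nat.choose_pos h)
      obtain ⟨hvz, hvn⟩ := Multiset.mem_powersetCard.1 hv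
      refine ⟨v, hvz, hvn.le, (hN u hu).trans (Ideal.mem_span_singleton.1 (hn ?_))⟩
      rw [← hvn]
      exact prod_mem_pow_card fun w hw => hz.1 w (Multiset.mem_of_le hvz hw)
  obtain ⟨x, rfl⟩ := Multiset.le_iff_exists_add.1 hvz
  have hvi : ∀ w ∈ v, Irreducible w := fun w hw => hz.1 w (Multiset.mem_add.2 (.inl hw))
  have hv0 : v.prod ≠ 0 := Multiset.prod_ne_zero fun h => (hvi 0 h).ne_zero rfl
  obtain ⟨c, hc⟩ := huv
  obtain ⟨t, hti, htc⟩ := exists_isFactorization hR (right_ne_zero_of_mul (hc ▸ hv0))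
  have hvb : v.prod ∣ b ^ (N * n) := by
    have h : v.prod ∣ (v.map fun _ => b ^ N).prod := by
      simpa using Multiset.prod_dvd_prod_of_dvd (S := v) id (fun _ => b ^ N)
        fun w hw => hN w (hvi w hw)
    rw [Multiset.map_const', Multiset.prod_replicate, ← pow_mul] at h
    exact h.trans (pow_dvd_pow b (Nat.mul_le_mul_left N hvn))
  have htl : Multiset.card t < l := by
    by_contra! h
    refine hl (Ideal.pow_le_pow_right h (Ideal.mem_of_dvd _ ?_ (prod_mem_pow_card hti)))
    exact htc.dvd.trans ((Dvd.intro_left u hc.symm).trans hvb)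
  refine ⟨x + u ::ₘ t, ⟨fun w hw => ?_, ?_⟩, ⟨u, by simp, .refl _⟩, ?_⟩
  · rcases Multiset.mem_add.1 hw with h | h
    · exact hz.1 w (Multiset.mem_add.2 (.inr h))
    · rcases Multiset.mem_cons.1 h with rfl | h
      exacts [hu, hti w h]
  · refine Associated.trans ?_ hz.2
    rw [Multiset.prod_add, Multiset.prod_add, Multiset.prod_cons, hc, mul_comm]
    exact (htc.mul_left u).mul_right x.prod
  · rw [add_comm v x]
    refine (fdistD_add_le x v _).trans ?_
    rw [Multiset.card_cons]
    omega

lemma irreducible_dvd_pow_of_tameBound (hR : StronglyPrimaryDomain R) {x u : R}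
    (hx : Irreducible x) (hu : Irreducible u) {N : ℕ} (hN : TameBoundD R u N) :
    u ∣ x ^ (N + 1) := by
  obtain ⟨n, hn⟩ := exists_dvd_pow hR hx.not_isUnit hu.ne_zero
  have hzi : ∀ v ∈ Multiset.replicate n x, v = x := fun v hv => Multiset.eq_of_mem_replicate hv
  obtain ⟨z', hz', ⟨v₀, hv₀, hvu⟩, hdist⟩ := hN (x ^ n) (pow_ne_zero _ hx.ne_zero) hn
    (Multiset.replicate n x) ⟨fun v hv => hzi v hv ▸ hx, by simp⟩
  obtain ⟨y, y', v, w, hy, rfl, hrel, hcard⟩ := Nat.sInf_mem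
    (s := {N : ℕ | ∃ y y' v w : Multiset R, Multiset.replicate n x = y + v ∧ z' = y' + w ∧
      Multiset.Rel Associated y y' ∧ max (Multiset.card v) (Multiset.card w) ≤ N})
    ⟨_, 0, 0, _, z', (zero_add _).symm, (zero_add _).symm, .zero, le_rfl⟩
  have hvN : Multiset.card v ≤ N := (le_max_left _ _).trans (hcard.trans hdist)
  rcases Multiset.mem_add.1 hv₀ with h | h
  · obtain ⟨e, he, hev⟩ := Multiset.exists_mem_of_rel_of_mem (Multiset.rel_flip.2 hrel) h
    have : e = x := hzi e (hy ▸ Multiset.mem_add.2 (.inl he))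
    subst this
    exact hvu.symm.dvd.trans (Associated.dvd hev.symm |>.trans (dvd_pow_self _ N.succ_ne_zero))
  · have hvx : v.prod = x ^ Multiset.card v := by
      rw [Multiset.eq_replicate_card.2 fun e he => hzi e (hy ▸ Multiset.mem_add.2 (.inr he)),
        Multiset.prod_replicate, Multiset.card_replicate]
    have hyy : Associated y.prod y'.prod := by
      rw [← Associates.mk_eq_mk_iff_associated, ← Associates.prod_mk, ← Associates.prod_mk,
        Associates.rel_associated_iff_map_eq_map.1 hrel]
    have hprod : Associated (y.prod * v.prod) (y'.prod * w.prod) := by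
      rw [← Multiset.prod_add, ← Multiset.prod_add, ← hy]
      simpa using hz'.2.symm
    have hy0 : y.prod ≠ 0 := Multiset.prod_ne_zero fun h0 =>
      hx.ne_zero (hzi 0 (hy ▸ Multiset.mem_add.2 (.inl h0))).symm
    have hvw := hprod.of_mul_left hyy hy0
    calc u ∣ v₀ := hvu.symm.dvd
      _ ∣ w.prod := Multiset.dvd_prod h
      _ ∣ v.prod := hvw.symm.dvd
      _ ∣ x ^ (N + 1) := hvx ▸ pow_dvd_pow x (by omega)

lemma lambda_eq_top_of_globallyTame (hR : StronglyPrimaryDomain R) (h : GloballyTameD R) :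
    LambdaD R = ⊤ := by
  obtain ⟨N, hN⟩ := h
  obtain ⟨x, hx⟩ := exists_irreducible hR
  refine ENat.eq_top_iff_forall_ge.2 fun l => ?_
  have ha : x ^ ((N + 1) * l) ≠ 0 := pow_ne_zero _ hx.ne_zero
  have hne : (lengthSetD R (x ^ ((N + 1) * l))).Nonempty :=
    let ⟨s, hs⟩ := exists_isFactorization hR ha
    ⟨_, s, rfl, hs.1, hs.2⟩
  refine le_trans ?_ (le_iSup₂_of_le _ ha (le_iSup_of_le hne le_rfl))
  obtain ⟨s, hs, hsi, hsa⟩ := Nat.sInf_mem hne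
  rw [← hs]
  have hdvd : s.prod ∣ (s.map fun _ => x ^ (N + 1)).prod := by
    simpa using Multiset.prod_dvd_prod_of_dvd (S := s) id (fun _ => x ^ (N + 1))
      fun u hu => irreducible_dvd_pow_of_tameBound hR hx (hsi u hu) (hN u (hsi u hu))
  rw [Multiset.map_const', Multiset.prod_replicate, ← pow_mul] at hdvd
  have hle := (pow_dvd_pow_iff hx.ne_zero hx.not_isUnit).1 (hsa.symm.dvd.trans hdvd)
  exact_mod_cast Nat.le_of_mul_le_mul_left hle N.succ_pos

end StronglyPrimaryDomain

/-- A strongly primary domain `R` is globally tame if and only if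
`Λ(R) = ∞`. -/
theorem stmt8 (R : Type*) [CommRing R] [IsDomain R] [IsLocalRing R]
    (hsp : StronglyPrimaryDomain R) :
    GloballyTameD R ↔ LambdaD R = ⊤ := by
  exact ⟨StronglyPrimaryDomain.lambda_eq_top_of_globallyTame hsp,
    StronglyPrimaryDomain.globallyTame_of_lambda_eq_top hsp⟩
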